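/- Let G be a finite simple (P2 ∪ P4, diamond)-free graph with ω(G) = 5, let A be a maximum clique of G, and suppose the clique number of G − A equals 3. Then χ(G) = 5. -/

import Mathlib

open SimpleGraph

/-- The disjoint union `P2 ∪ P4`: vertices `0,1` form a `P2` and `2,3,4,5` form a `P4`. -/
def P2UP4 : SimpleGraph (Fin 6) :=
  SimpleGraph.fromRel (fun i j =>
    ((i : ℕ) = 0 ∧ (j : ℕ) = 1) ∨ ((i : ℕ) = 2 ∧ (j : ℕ) = 3) ∨
    ((i : ℕ) = 3 ∧ (j : ℕ) = 4) ∨ ((i : ℕ) = 4 ∧ (j : ℕ) = 5))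

/-- The diamond: `K4` minus the edge `{0,1}`. -/
def diamond : SimpleGraph (Fin 4) :=
  SimpleGraph.fromRel (fun i j =>
    ¬(((i : ℕ) = 0 ∧ (j : ℕ) = 1) ∨ ((i : ℕ) = 1 ∧ (j : ℕ) = 0)))

/-- `G` contains no induced subgraph isomorphic to `H`. -/
def IsIndFree {α β : Type*} (H : SimpleGraph α) (G : SimpleGraph β) : Prop :=
  IsEmpty (H ↪g G)

/-- `c` properly colours the vertices of `S`, and no `v ∈ S` receives its forbidden colour `ℓ v`. -/
def AvoidsOn {W : Type*} (H : SimpleGraph W) (ℓ : W → Option (Fin 5)) (S : Finset W)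
    (c : W → Fin 5) : Prop :=
  (∀ v ∈ S, ℓ v ≠ some (c v)) ∧ ∀ v ∈ S, ∀ w ∈ S, H.Adj v w → c v ≠ c w

open Classical in
theorem exists_avoidsOn_of_erase {W : Type*} {H : SimpleGraph W} {ℓ : W → Option (Fin 5)}
    {S : Finset W} {v : W} (hdeg : (S.filter (H.Adj v)).card ≤ 3)
    (ih : ∃ c, AvoidsOn H ℓ (S.erase v) c) : ∃ c, AvoidsOn H ℓ S c := by
  obtain ⟨c, hc1, hc2⟩ := ih
  set F : Finset (Fin 5) := (S.filter (H.Adj v)).image c ∪ (ℓ v).toFinset with hF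
  have hcard : F.card < (Finset.univ : Finset (Fin 5)).card := by
    have h1 : F.card ≤ _ + _ := Finset.card_union_le _ _
    have h2 : ((S.filter (H.Adj v)).image c).card ≤ 3 := Finset.card_image_le.trans hdeg
    have h3 : (ℓ v).toFinset.card ≤ 1 := by cases ℓ v <;> simp
    simp only [Finset.card_univ, Fintype.card_fin]
    omega
  obtain ⟨k, -, hk⟩ := Finset.exists_mem_notMem_of_card_lt_card hcard
  simp only [hF, Finset.mem_union, Finset.mem_image, Finset.mem_filter, Option.mem_toFinset,
    Option.mem_def, not_or, not_exists, not_and, and_imp] at hk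
  refine ⟨Function.update c v k, fun w hw => ?_, fun w hw x hx hwx => ?_⟩
  · by_cases h : w = v
    · subst h; simpa using hk.2
    · simpa [h] using hc1 w (Finset.mem_erase.2 ⟨h, hw⟩)
  · by_cases h : w = v
    · subst h
      have := hk.1 x hx hwx
      simpa [hwx.ne'] using Ne.symm this
    · by_cases h' : x = v
      · subst h'
        have := hk.1 w hw hwx.symm
        simpa [h] using this
      · simpa [h, h'] using hc2 w (Finset.mem_erase.2 ⟨h, hw⟩) x (Finset.mem_erase.2 ⟨h', hx⟩) hwx

/-- Two independent sets with no edges to the remaining vertices of `S` can be coloured by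
`{0, 1}` and `{2, 3}`. -/
theorem exists_avoidsOn_of_bipartite {W : Type*} {H : SimpleGraph W} {ℓ : W → Option (Fin 5)}
    {S : Finset W} (P Q : W → Prop)
    (hP : ∀ v w, P v → P w → ¬ H.Adj v w) (hQ : ∀ v w, Q v → Q w → ¬ H.Adj v w)
    (hD : ∀ v ∈ S, ∀ w ∈ S, P v ∨ Q v → ¬ (P w ∨ Q w) → ¬ H.Adj v w)
    (hne : ∃ v ∈ S, P v ∨ Q v)
    (ih : ∀ T ⊂ S, ∃ c, AvoidsOn H ℓ T c) : ∃ c, AvoidsOn H ℓ S c := by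
  classical
  obtain ⟨u, huS, hu⟩ := hne
  obtain ⟨c, hc1, hc2⟩ := ih (S.filter fun v => ¬ (P v ∨ Q v)) <|
    Finset.filter_ssubset.2 ⟨u, huS, not_not.2 hu⟩
  simp only [Finset.mem_filter] at hc1 hc2
  have h01 : (0 : Fin 5) ≠ 1 := by decide
  have h23 : (2 : Fin 5) ≠ 3 := by decide
  have hdisj : (0 : Fin 5) ≠ 2 ∧ (0 : Fin 5) ≠ 3 ∧ (1 : Fin 5) ≠ 2 ∧ (1 : Fin 5) ≠ 3 := by decide
  refine ⟨fun v => if P v then (if ℓ v = some 0 then 1 else 0)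
    else if Q v then (if ℓ v = some 2 then 3 else 2) else c v, fun v hv => ?_,
    fun v hv w hw hvw => ?_⟩
  · have := hc1 v
    grind
  · have h1 := hP v w
    have h2 := hQ v w
    have h3 := hD v hv w hw
    have h4 := hD w hw v hv
    have h5 := hc2 v
    have h6 := hvw.symm
    grind

open Classical in
/-- If common neighbours of adjacent vertices are unique and every vertex of `S` has at least four
neighbours in `S`, then a vertex lying on no induced `P4` is in a complete bipartite component. -/
theorem exists_avoidsOn_of_not_mem_path {W : Type*} {H : SimpleGraph W} {ℓ : W → Option (Fin 5)}
    {S : Finset W}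
    (hU : ∀ a b c d, H.Adj a b → H.Adj a c → H.Adj b c → H.Adj a d → H.Adj b d → c = d)
    (hdeg : ∀ v ∈ S, 3 < (S.filter (H.Adj v)).card)
    {z : W} (hz : z ∈ S)
    (hend : ∀ p q r, H.Adj p q → H.Adj q r → H.Adj r z → ¬ H.Adj p r → ¬ H.Adj q z → H.Adj p z)
    (hmid : ∀ p q s, H.Adj p q → H.Adj q z → H.Adj z s → ¬ H.Adj p z → ¬ H.Adj q s → H.Adj p s)
    (ih : ∀ T ⊂ S, ∃ c, AvoidsOn H ℓ T c) : ∃ c, AvoidsOn H ℓ S c := by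
  have nbr (v : W) (hv : v ∈ S) (a b : W) : ∃ x ∈ S, H.Adj v x ∧ x ≠ a ∧ x ≠ b := by
    have h : ({a, b} : Finset W).card < (S.filter (H.Adj v)).card :=
      Finset.card_le_two.trans_lt (by have := hdeg v hv; omega)
    obtain ⟨x, hx, hx'⟩ := Finset.exists_mem_notMem_of_card_lt_card h
    simp at hx hx'
    exact ⟨x, hx.1, hx.2, hx'⟩
  have hNind : ∀ x ∈ S, ∀ y ∈ S, H.Adj z x → H.Adj z y → ¬ H.Adj x y := by
    intro x hx y hy hzx hzy hxy
    obtain ⟨w, hw, hxw, hwz, hwy⟩ := nbr x hx z y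
    obtain ⟨u, hu, hzu, hux, huy⟩ := nbr z hz x y
    have hwz' : ¬ H.Adj z w := fun h => hwy (hU z x w y hzx h hxw hzy hxy)
    have hwy' : ¬ H.Adj y w := fun h => hwz (hU x y w z hxy hxw h hzx.symm hzy.symm)
    have hxu : ¬ H.Adj x u := fun h => huy (hU z x u y hzx hzu h hzy hxy)
    have hyu : ¬ H.Adj y u := fun h => hux (hU z y u x hzy hzu h hzx hxy.symm)
    have h1 := hmid w x u hxw.symm hzx.symm hzu (fun h => hwz' h.symm) hxu
    exact hwy' (hmid w u y h1 hzu.symm hzy (fun h => hwz' h.symm)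
      (fun h => hyu h.symm)).symm
  have hcompl : ∀ x ∈ S, ∀ w ∈ S, H.Adj z x → H.Adj x w → w ≠ z → ∀ u ∈ S, H.Adj z u →
      H.Adj w u := by
    intro x hx w hw hzx hxw hwz u hu hzu
    by_cases hux : u = x
    · exact hux ▸ hxw.symm
    have hzw : ¬ H.Adj z w := fun h => hNind x hx w hw hzx h hxw
    exact hmid w x u hxw.symm hzx.symm hzu (fun h => hzw h.symm)
      (hNind x hx u hu hzx hzu)
  refine exists_avoidsOn_of_bipartite
    (fun v => v ∈ S ∧ (v = z ∨ ∃ x ∈ S, H.Adj z x ∧ H.Adj x v))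
    (fun v => v ∈ S ∧ H.Adj z v) ?_ ?_ ?_ ⟨z, hz, Or.inl ⟨hz, Or.inl rfl⟩⟩ ih
  · rintro v w ⟨hv, hv'⟩ ⟨hw, hw'⟩ hvw
    rcases eq_or_ne v z with rfl | hvz
    · rcases hw' with rfl | ⟨x, hx, hzx, hxw⟩
      · exact hvw.ne rfl
      · exact hNind x hx w hw hzx hvw hxw
    rcases eq_or_ne w z with rfl | hwz
    · rcases hv' with rfl | ⟨x, hx, hzx, hxv⟩
      · exact hvw.ne rfl
      · exact hNind x hx v hv hzx hvw.symm hxv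
    obtain ⟨x, hx, hzx, hxv⟩ := hv'.resolve_left hvz
    obtain ⟨y, hy, hzy, hyw⟩ := hw'.resolve_left hwz
    obtain ⟨u, hu, hzu, hux, -⟩ := nbr z hz x x
    exact hux (hU v w u x hvw (hcompl x hx v hv hzx hxv hvz u hu hzu)
      (hcompl y hy w hw hzy hyw hwz u hu hzu) hxv.symm (hcompl y hy w hw hzy hyw hwz x hx hzx))
  · rintro v w ⟨hv, hzv⟩ ⟨hw, hzw⟩
    exact hNind v hv w hw hzv hzw
  · rintro v hv w hw (⟨-, rfl | ⟨x, hx, hzx, hxv⟩⟩ | ⟨-, hzv⟩) hn hvw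
    · exact hn (Or.inr ⟨hw, hvw⟩)
    · have hzw : ¬ H.Adj z w := fun h => hn (Or.inr ⟨hw, h⟩)
      have hxw : ¬ H.Adj x w := fun h => hn (Or.inl ⟨hw, Or.inr ⟨x, hx, hzx, h⟩⟩)
      exact hzw (hend w v x hvw.symm hxv.symm hzx.symm
        (fun h => hxw h.symm) (fun h => hNind x hx v hv hzx h.symm hxv)).symm
    · exact hn (Or.inl ⟨hw, Or.inr ⟨v, hv, hzv, hvw⟩⟩)

open Classical in
/-- If an edge `ab` is contained in no induced `P4`, the same holds for edges to common neighbours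
of `a` and `b`, and degrees in `S` are at least four, then `ab` lies in a complete bipartite
component. -/
theorem exists_avoidsOn_of_edge {W : Type*} {H : SimpleGraph W} {ℓ : W → Option (Fin 5)}
    {S : Finset W}
    (hU : ∀ a b c d, H.Adj a b → H.Adj a c → H.Adj b c → H.Adj a d → H.Adj b d → c = d)
    (hdeg : ∀ v ∈ S, 3 < (S.filter (H.Adj v)).card)
    {i : Fin 5} (hM : ∀ a b c, H.Adj a b → H.Adj a c → H.Adj b c → ℓ a = some i → ℓ b = some i →
      ℓ c = some i)
    (hend : ∀ p q r s, H.Adj p q → H.Adj q r → H.Adj r s → ¬ H.Adj p r → ¬ H.Adj q s →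
      ℓ r = some i → ℓ s = some i → H.Adj p s)
    (hmid : ∀ p q r s, H.Adj p q → H.Adj q r → H.Adj r s → ¬ H.Adj p r → ¬ H.Adj q s →
      ℓ q = some i → ℓ r = some i → H.Adj p s)
    {a b : W} (ha : a ∈ S) (hb : b ∈ S) (hab : H.Adj a b) (hla : ℓ a = some i) (hlb : ℓ b = some i)
    (ih : ∀ T ⊂ S, ∃ c, AvoidsOn H ℓ T c) : ∃ c, AvoidsOn H ℓ S c := by
  have nbr (v : W) (hv : v ∈ S) (a b c : W) : ∃ x ∈ S, H.Adj v x ∧ x ≠ a ∧ x ≠ b ∧ x ≠ c := by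
    have h : ({a, b, c} : Finset W).card < (S.filter (H.Adj v)).card :=
      Finset.card_le_three.trans_lt (hdeg v hv)
    obtain ⟨x, hx, hx'⟩ := Finset.exists_mem_notMem_of_card_lt_card h
    simp at hx hx'
    exact ⟨x, hx.1, hx.2, hx'⟩
  have hXY : ∀ a b x y, ℓ a = some i → ℓ b = some i → H.Adj a b → H.Adj a x → H.Adj b y →
      ¬ H.Adj b x → ¬ H.Adj a y → H.Adj x y := by
    intro a b x y hla hlb hab hax hby hbx hay
    exact hmid x a b y hax.symm hab hby
      (fun h => hbx h.symm) hay hla hlb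
  have hno : ∀ c ∈ S, H.Adj a c → ¬ H.Adj b c := by
    intro c hc hac hbc
    have hlc := hM a b c hab hac hbc hla hlb
    obtain ⟨x, hx, hax, hxb, hxc, -⟩ := nbr a ha b c c
    obtain ⟨x', hx', hax', hxb', hxc', hxx'⟩ := nbr a ha b c x
    obtain ⟨y, hy, hby, hya, hyc, -⟩ := nbr b hb a c c
    obtain ⟨w, hw, hcw, hwa, hwb, -⟩ := nbr c hc a b b
    have key : ∀ p q r x, H.Adj p q → H.Adj p r → H.Adj q r → H.Adj p x → x ≠ r →
        ¬ H.Adj q x := fun p q r x hpq hpr hqr hpx hxr hqx =>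
      hxr (hU p q x r hpq hpx hqx hpr hqr)
    have h1 := key a b c x hab hac hbc hax hxc
    have h2 := key a c b x hac hab hbc.symm hax hxb
    have h1' := key a b c x' hab hac hbc hax' hxc'
    have h2' := key a c b x' hac hab hbc.symm hax' hxb'
    have h3 := key b a c y hab.symm hbc hac hby hyc
    have h4 := key b c a y hbc hab.symm hac.symm hby hya
    have h5 := key c a b w hac.symm hbc.symm hab hcw hwb
    have h6 := key c b a w hbc.symm hac.symm hab.symm hcw hwa
    have exy := hXY a b x y hla hlb hab hax hby h1 h3
    have exy' := hXY a b x' y hla hlb hab hax' hby h1' h3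
    have exw := hXY a c x w hla hlc hac hax hcw h2 h5
    have exw' := hXY a c x' w hla hlc hac hax' hcw h2' h5
    have eyw := hXY b c y w hlb hlc hbc hby hcw h4 h6
    exact hxx' (hU y w x' x eyw exy'.symm exw'.symm exy.symm exw.symm)
  have hXind : ∀ a b, a ∈ S → b ∈ S → H.Adj a b → ℓ a = some i → ℓ b = some i →
      (∀ c ∈ S, H.Adj a c → ¬ H.Adj b c) →
      ∀ x ∈ S, ∀ x' ∈ S, H.Adj a x → H.Adj a x' → ¬ H.Adj x x' := by
    intro a b ha hb hab hla hlb hno x hx x' hx' hax hax' hxx'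
    rcases eq_or_ne x b with rfl | hxb
    · exact hno x' hx' hax' hxx'
    rcases eq_or_ne x' b with rfl | hxb'
    · exact hno x hx hax hxx'.symm
    obtain ⟨y, hy, hby, hya, -⟩ := nbr b hb a a a
    have hay : ¬ H.Adj a y := fun h => hno y hy h hby
    exact hya (hU x x' y a hxx'
      (hXY a b x y hla hlb hab hax hby (hno x hx hax) hay)
      (hXY a b x' y hla hlb hab hax' hby (hno x' hx' hax') hay) hax.symm hax'.symm)
  have hno' : ∀ c ∈ S, H.Adj b c → ¬ H.Adj a c := fun c hc h h' => hno c hc h' h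
  have hout : ∀ a b, ℓ a = some i → ℓ b = some i → H.Adj a b → (∀ c ∈ S, H.Adj a c → ¬ H.Adj b c) →
      ∀ x ∈ S, H.Adj a x → ∀ w ∈ S, ¬ H.Adj a w → ¬ H.Adj b w → ¬ H.Adj x w := by
    intro a b hla hlb hab hno x hx hax w hw haw hbw hxw
    exact hbw (hend w x a b hxw.symm hax.symm hab (fun h => haw h.symm) (fun h => hno x hx hax h.symm)
      hla hlb).symm
  refine exists_avoidsOn_of_bipartite (fun v => v ∈ S ∧ H.Adj a v) (fun v => v ∈ S ∧ H.Adj b v)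
    ?_ ?_ ?_ ⟨b, hb, Or.inl ⟨hb, hab⟩⟩ ih
  · rintro v w ⟨hv, hav⟩ ⟨hw, haw⟩
    exact hXind a b ha hb hab hla hlb hno v hv w hw hav haw
  · rintro v w ⟨hv, hbv⟩ ⟨hw, hbw⟩
    exact hXind b a hb ha hab.symm hlb hla hno' v hv w hw hbv hbw
  · rintro v hv w hw (⟨-, h⟩ | ⟨-, h⟩) hn
    · exact hout a b hla hlb hab hno v hv h w hw (fun h => hn (Or.inl ⟨hw, h⟩))
        (fun h => hn (Or.inr ⟨hw, h⟩))
    · exact hout b a hlb hla hab.symm hno' v hv h w hw (fun h => hn (Or.inr ⟨hw, h⟩))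
        (fun h => hn (Or.inl ⟨hw, h⟩))

theorem exists_avoidsOn {W : Type*} {H : SimpleGraph W} {ℓ : W → Option (Fin 5)}
    (hU : ∀ a b c d, H.Adj a b → H.Adj a c → H.Adj b c → H.Adj a d → H.Adj b d → c = d)
    (hM : ∀ i a b c, H.Adj a b → H.Adj a c → H.Adj b c → ℓ a = some i → ℓ b = some i →
      ℓ c = some i)
    (hP : ∀ p q r s, H.Adj p q → H.Adj q r → H.Adj r s → ¬ H.Adj p r → ¬ H.Adj q s →
      ¬ H.Adj p s →
      ℓ r ≠ none ∧ ℓ s ≠ none ∧ ℓ q ≠ ℓ r ∧ ℓ r ≠ ℓ s)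
    (S : Finset W) : ∃ c, AvoidsOn H ℓ S c := by
  classical
  induction S using Finset.strongInduction with
  | H S ih =>
  by_cases hlow : ∃ v ∈ S, (S.filter (H.Adj v)).card ≤ 3
  · obtain ⟨v, hv, hdeg⟩ := hlow
    exact exists_avoidsOn_of_erase hdeg (ih _ (Finset.erase_ssubset hv))
  have hdeg : ∀ v ∈ S, 3 < (S.filter (H.Adj v)).card := by simpa using hlow
  by_cases hz : ∃ z ∈ S, ℓ z = none
  · obtain ⟨z, hzS, hz⟩ := hz
    refine exists_avoidsOn_of_not_mem_path hU hdeg hzS ?_ ?_ ih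
    · intro p q r h1 h2 h3 h4 h5
      by_contra h6
      exact (hP p q r z h1 h2 h3 h4 h5 h6).2.1 hz
    · intro p q s h1 h2 h3 h4 h5
      by_contra h6
      exact (hP p q z s h1 h2 h3 h4 h5 h6).1 hz
  by_cases hm : ∃ i, ∃ a ∈ S, ∃ b ∈ S, H.Adj a b ∧ ℓ a = some i ∧ ℓ b = some i
  · obtain ⟨i, a, ha, b, hb, hab, hla, hlb⟩ := hm
    refine exists_avoidsOn_of_edge hU hdeg (hM i) ?_ ?_ ha hb hab hla hlb ih
    · intro p q r s h1 h2 h3 h4 h5 hr hs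
      by_contra h6
      exact (hP p q r s h1 h2 h3 h4 h5 h6).2.2.2 (hr.trans hs.symm)
    · intro p q r s h1 h2 h3 h4 h5 hq hr
      by_contra h6
      exact (hP p q r s h1 h2 h3 h4 h5 h6).2.2.1 (hq.trans hr.symm)
  refine ⟨fun v => (ℓ v).getD 0 + 1, fun v hv h => ?_, fun v hv w hw hvw h => ?_⟩
  · obtain ⟨i, hi⟩ := Option.ne_none_iff_exists'.1 fun h => hz ⟨v, hv, h⟩
    simp [hi] at h
  · obtain ⟨i, hi⟩ := Option.ne_none_iff_exists'.1 fun h => hz ⟨v, hv, h⟩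
    obtain ⟨j, hj⟩ := Option.ne_none_iff_exists'.1 fun h => hz ⟨w, hw, h⟩
    simp only [hi, hj, Option.getD_some, add_left_inj] at h
    exact hm ⟨i, v, hv, w, hw, hvw, hi, h ▸ hj⟩

theorem IsIndFree.diamond_adj {V : Type*} {G : SimpleGraph V} (h : IsIndFree diamond G)
    {a b c d : V} (hab : G.Adj a b) (hac : G.Adj a c) (hbc : G.Adj b c) (had : G.Adj a d)
    (hbd : G.Adj b d) (hcd : c ≠ d) : G.Adj c d := by
  by_contra hn
  have hn' : ¬ G.Adj d c := fun h => hn h.symm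
  refine h.false ⟨⟨![c, d, a, b], ?_⟩, ?_⟩
  · intro i j hij
    have := hab.ne; have := hac.ne; have := hbc.ne; have := had.ne; have := hbd.ne
    fin_cases i <;> fin_cases j <;> simp_all
  · intro i j
    change G.Adj (![c, d, a, b] i) (![c, d, a, b] j) ↔ _
    fin_cases i <;> fin_cases j <;>
      simp [diamond, hab, hac, hbc, had, hbd, hn, hn', hab.symm, hac.symm, hbc.symm, had.symm,
        hbd.symm]

theorem IsIndFree.not_P2UP4 {V : Type*} {G : SimpleGraph V} (h : IsIndFree P2UP4 G)
    {u v p q r s : V} (huv : G.Adj u v) (hpq : G.Adj p q) (hqr : G.Adj q r) (hrs : G.Adj r s)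
    (npr : ¬ G.Adj p r) (nqs : ¬ G.Adj q s) (nps : ¬ G.Adj p s)
    (hu : ∀ x ∈ [p, q, r, s], ¬ G.Adj u x) (hv : ∀ x ∈ [p, q, r, s], ¬ G.Adj v x) : False := by
  simp only [List.mem_cons, List.not_mem_nil, or_false, forall_eq_or_imp, forall_eq] at hu hv
  obtain ⟨u1, u2, u3, u4⟩ := hu
  obtain ⟨v1, v2, v3, v4⟩ := hv
  have hadj : ∀ i j, G.Adj (![u, v, p, q, r, s] i) (![u, v, p, q, r, s] j) ↔ P2UP4.Adj i j := by
    intro i j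
    fin_cases i <;> fin_cases j <;>
      simp [P2UP4, huv, hpq, hqr, hrs, huv.symm, hpq.symm, hqr.symm, hrs.symm, npr, nps, nqs,
        u1, u2, u3, u4, v1, v2, v3, v4, G.adj_comm r p, G.adj_comm s p, G.adj_comm s q,
        G.adj_comm _ u, G.adj_comm _ v]
  have htwin : ∀ i j, (∀ k, P2UP4.Adj i k ↔ P2UP4.Adj j k) → i = j := by
    simp only [P2UP4, fromRel_adj]
    decide
  exact h.false ⟨⟨![u, v, p, q, r, s], fun i j hij => htwin i j fun k => by
    rw [← hadj, ← hadj]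
    exact iff_of_eq (congrArg (G.Adj · _) hij)⟩, hadj _ _⟩

/-- A vertex outside a maximum clique of a diamond-free graph has at most one neighbour in it. -/
theorem IsIndFree.eq_of_adj_maximum_clique {V : Type*} [Fintype V] {G : SimpleGraph V}
    (h : IsIndFree diamond G) {A : Finset V} (hA : G.IsClique (A : Set V))
    (hAmax : A.card = G.cliqueNum) {w u v : V} (hw : w ∉ A) (hu : u ∈ A) (hv : v ∈ A)
    (hwu : G.Adj w u) (hwv : G.Adj w v) : u = v := by
  classical
  by_contra huv
  have hall : ∀ x ∈ A, G.Adj w x := by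
    intro x hx
    rcases eq_or_ne x u with rfl | hxu
    · exact hwu
    rcases eq_or_ne x v with rfl | hxv
    · exact hwv
    exact h.diamond_adj (hA hu hv huv) hwu.symm hwv.symm (hA hu hx hxu.symm) (hA hv hx hxv.symm)
      (by rintro rfl; exact hw hx)
  have hcl : G.IsClique ((insert w A : Finset V) : Set V) := by
    rw [Finset.coe_insert, isClique_insert]
    exact ⟨hA, fun x hx _ => hall x hx⟩
  have := hcl.card_le_cliqueNum
  rw [Finset.card_insert_of_notMem hw] at this
  omega

theorem chi_eq_five_of_omega_five_k_eq_three {V : Type*} [Fintype V] [DecidableEq V]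
    (G : SimpleGraph V)
    (h1 : IsIndFree P2UP4 G) (h2 : IsIndFree diamond G) (hw : G.cliqueNum = 5)
    (A : Finset V) (hA : G.IsClique (A : Set V)) (hAmax : A.card = G.cliqueNum)
    (hk : (G.induce ((A : Set V)ᶜ)).cliqueNum = 3) :
    G.chromaticNumber = 5 := by
  classical
  have hA5 : A.card = 5 := hAmax.trans hw
  refine le_antisymm ?_ (by simpa [hA5] using hA.card_le_chromaticNumber)
  let e : A ≃ Fin 5 := A.equivFinOfCardEq hA5
  let ℓ : ((A : Set V)ᶜ : Set V) → Option (Fin 5) := fun w =>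
    if h : ∃ u : A, G.Adj w u then some (e h.choose) else none
  have hℓ : ∀ w (u : A), ℓ w = some (e u) ↔ G.Adj w u := by
    intro w u
    have huniq : ∀ u v : A, G.Adj w u → G.Adj w v → u = v := fun u v hu hv =>
      Subtype.ext (h2.eq_of_adj_maximum_clique hA hAmax w.2 u.2 v.2 hu hv)
    by_cases h : ∃ u : A, G.Adj w u
    · simp only [ℓ, h, dite_true, Option.some.injEq, e.apply_eq_iff_eq]
      exact ⟨fun h' => h' ▸ h.choose_spec, fun h' => huniq _ _ h.choose_spec h'⟩
    · simp only [ℓ, h, dite_false, reduceCtorEq, false_iff]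
      exact fun h' => h ⟨u, h'⟩
  have hU : ∀ a b c d : ((A : Set V)ᶜ : Set V), G.Adj a b → G.Adj a c → G.Adj b c → G.Adj a d →
      G.Adj b d → c = d := by
    intro a b c d hab hac hbc had hbd
    by_contra hcd
    have hcd' : G.Adj c d := h2.diamond_adj hab hac hbc had hbd (fun h => hcd (Subtype.ext h))
    have h4 : (G.induce ((A : Set V)ᶜ)).IsNClique 4 {a, b, c, d} := by
      refine IsNClique.insert (n := 3) (is3Clique_triple_iff.2 ⟨hbc, hbd, hcd'⟩) ?_
      simp [hab, hac, had]
    have := h4.isClique.card_le_cliqueNum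
    rw [h4.card_eq, hk] at this
    omega
  have hM : ∀ i (a b c : ((A : Set V)ᶜ : Set V)), G.Adj a b → G.Adj a c → G.Adj b c →
      ℓ a = some i → ℓ b = some i → ℓ c = some i := by
    intro i a b c hab hac hbc hla hlb
    obtain ⟨u, rfl⟩ := e.surjective i
    rw [hℓ] at hla hlb ⊢
    exact h2.diamond_adj hab hac hbc hla hlb (by rintro h; exact c.2 (h ▸ u.2))
  have hP : ∀ p q r s : ((A : Set V)ᶜ : Set V), G.Adj p q → G.Adj q r → G.Adj r s →
      ¬ G.Adj p r → ¬ G.Adj q s → ¬ G.Adj p s →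
      ℓ r ≠ none ∧ ℓ s ≠ none ∧ ℓ q ≠ ℓ r ∧ ℓ r ≠ ℓ s := by
    intro p q r s hpq hqr hrs npr nqs nps
    let F : Finset (Fin 5) :=
      (ℓ p).toFinset ∪ (ℓ q).toFinset ∪ (ℓ r).toFinset ∪ (ℓ s).toFinset
    have hF : 4 ≤ F.card := by
      by_contra! hlt
      have h1lt : 1 < Fᶜ.card := by rw [Finset.card_compl, Fintype.card_fin]; omega
      obtain ⟨i, hi, j, hj, hij⟩ := Finset.one_lt_card.1 h1lt
      obtain ⟨u, rfl⟩ := e.surjective i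
      obtain ⟨v, rfl⟩ := e.surjective j
      simp only [F, Finset.mem_compl, Finset.mem_union, Option.mem_toFinset, Option.mem_def, hℓ,
        not_or] at hi hj
      have huv : G.Adj u v := hA u.2 v.2 fun h => hij (by rw [Subtype.ext h])
      refine h1.not_P2UP4 huv hpq hqr hrs npr nqs nps ?_ ?_ <;>
        simp only [List.mem_cons, List.not_mem_nil, or_false, forall_eq_or_imp, forall_eq,
          G.adj_comm u, G.adj_comm v]
      · tauto
      · tauto
    have hone : ∀ o : Option (Fin 5), o.toFinset.card ≤ 1 := fun o => by cases o <;> simp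
    have three : ∀ a b c : Option (Fin 5),
        (a.toFinset ∪ b.toFinset ∪ c.toFinset).card < 4 := fun a b c => by
      have := Finset.card_union_le (a.toFinset ∪ b.toFinset) c.toFinset
      have := Finset.card_union_le a.toFinset b.toFinset
      have := hone a; have := hone b; have := hone c
      omega
    refine ⟨fun h => ?_, fun h => ?_, fun h => ?_, fun h => ?_⟩
    · refine (three (ℓ p) (ℓ q) (ℓ s)).not_ge (hF.trans_eq ?_)
      simp [F, h]
    · refine (three (ℓ p) (ℓ q) (ℓ r)).not_ge (hF.trans_eq ?_)
      simp [F, h]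
    · refine (three (ℓ p) (ℓ r) (ℓ s)).not_ge (hF.trans_eq ?_)
      simp [F, h, Finset.union_assoc]
    · refine (three (ℓ p) (ℓ q) (ℓ s)).not_ge (hF.trans_eq ?_)
      simp [F, h, Finset.union_assoc]
  obtain ⟨c, hc1, hc2⟩ := exists_avoidsOn (H := G.induce ((A : Set V)ᶜ)) hU hM hP Finset.univ
  refine chromaticNumber_le_iff_colorable.2 ⟨Coloring.mk
    (fun x => if h : x ∈ A then e ⟨x, h⟩ else c ⟨x, by simpa using h⟩) ?_⟩
  intro x y hxy
  by_cases hx : x ∈ A <;> by_cases hy : y ∈ A <;> simp only [hx, hy, dite_true, dite_false]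
  · exact fun h => hxy.ne (congrArg Subtype.val (e.injective h))
  · exact fun h => hc1 ⟨y, by simpa using hy⟩ (Finset.mem_univ _)
      (h ▸ (hℓ ⟨y, by simpa using hy⟩ ⟨x, hx⟩).2 hxy.symm)
  · exact fun h => hc1 ⟨x, by simpa using hx⟩ (Finset.mem_univ _)
      (h ▸ (hℓ ⟨x, by simpa using hx⟩ ⟨y, hy⟩).2 hxy)
  · exact hc2 ⟨x, by simpa using hx⟩ (Finset.mem_univ _) ⟨y, by simpa using hy⟩
      (Finset.mem_univ _) hxy
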